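/- Let σ̄ and σ̄′ be two memoryless collective strategies for the team with the same support, i.e., for every state s and every team player p, the set of actions played with positive probability by σ_p at s equals the set of actions played with positive probability by σ′_p at s. Then σ̄ guarantees reaching T from the initial state with probability 1 against every opponent strategy if and only if σ̄′ does. -/

import Mathlib

/-!
Common framework: team concurrent stochastic reachability games.
-/

noncomputable section

/-- A concurrent game structure: finitely many players, finitely many states,
finitely many actions per player, available actions, and a probabilistic
transition function. -/
structure GameStructure where
  Player : Type
  [playerFin : Fintype Player]
  [playerDec : DecidableEq Player]
  State : Type
  [stateFin : Fintype State]
  [stateDec : DecidableEq State]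
  Act : Player → Type
  [actFin : ∀ p, Fintype (Act p)]
  [actDec : ∀ p, DecidableEq (Act p)]
  Av : (p : Player) → State → Finset (Act p)
  av_nonempty : ∀ p s, (Av p s).Nonempty
  trans : State → ((p : Player) → Act p) → State → ℝ
  trans_nonneg : ∀ s a t, 0 ≤ trans s a t
  trans_sum : ∀ s a, ∑ t, trans s a t = 1

attribute [instance] GameStructure.playerFin GameStructure.playerDec
  GameStructure.stateFin GameStructure.stateDec GameStructure.actFin GameStructure.actDec

/-- A (behavioural) strategy of player `p`: a distribution over available
actions, for every history `h` (the list of previously visited states)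
and current state `s`. -/
structure Strategy (G : GameStructure) (p : G.Player) where
  toFun : List G.State → G.State → G.Act p → ℝ
  nonneg : ∀ h s a, 0 ≤ toFun h s a
  support_av : ∀ h s a, a ∉ G.Av p s → toFun h s a = 0
  sum_one : ∀ h s, ∑ a, toFun h s a = 1

/-- A strategy is memoryless if it only depends on the current state. -/
def Strategy.Memoryless {G : GameStructure} {p : G.Player} (σ : Strategy G p) : Prop :=
  ∀ h h' s, σ.toFun h s = σ.toFun h' s

/-- A strategy is deterministic if it always plays a single action with probability 1. -/
def Strategy.Deterministic {G : GameStructure} {p : G.Player} (σ : Strategy G p) : Prop :=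
  ∀ h s, ∃ a, σ.toFun h s a = 1

/-- A selector of player `p` at state `s`: a distribution over the available actions. -/
structure Selector (G : GameStructure) (p : G.Player) (s : G.State) where
  toFun : G.Act p → ℝ
  nonneg : ∀ a, 0 ≤ toFun a
  support_av : ∀ a, a ∉ G.Av p s → toFun a = 0
  sum_one : ∑ a, toFun a = 1

/-- A game: a game structure together with a team, an absorbing target set,
and an initial state. -/
structure Game extends GameStructure where
  team : Finset Player
  target : Finset State
  init : State
  absorbing : ∀ t ∈ target, ∀ a, trans t a t = 1

namespace Game

variable (Gm : Game)

abbrev TeamPlayer := {p : Gm.Player // p ∈ Gm.team}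
abbrev OppPlayer := {p : Gm.Player // p ∉ Gm.team}

/-- A collective strategy: one strategy for each team player. -/
abbrev TeamStrategy := (p : Gm.TeamPlayer) → Strategy Gm.toGameStructure p.1
/-- An opponent strategy: one strategy for each player outside the team. -/
abbrev OppStrategy := (p : Gm.OppPlayer) → Strategy Gm.toGameStructure p.1

abbrev TeamAct := (p : Gm.TeamPlayer) → Gm.Act p.1
abbrev OppAct := (p : Gm.OppPlayer) → Gm.Act p.1

/-- A collective selector at state `s`. -/
abbrev TeamSelector (s : Gm.State) := (p : Gm.TeamPlayer) → Selector Gm.toGameStructure p.1 s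

def MemorylessTeam (σ : Gm.TeamStrategy) : Prop := ∀ p, (σ p).Memoryless
def DeterministicTeam (σ : Gm.TeamStrategy) : Prop := ∀ p, (σ p).Deterministic
def MemorylessOpp (τ : Gm.OppStrategy) : Prop := ∀ p, (τ p).Memoryless

/-- Combine a collective strategy and an opponent strategy into a full profile. -/
def combine (σ : Gm.TeamStrategy) (τ : Gm.OppStrategy) (p : Gm.Player) :
    Strategy Gm.toGameStructure p :=
  if h : p ∈ Gm.team then σ ⟨p, h⟩ else τ ⟨p, h⟩

/-- Combine a joint team action and a joint opponent action into a full action profile. -/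
def combineAct (a : Gm.TeamAct) (b : Gm.OppAct) (p : Gm.Player) : Gm.Act p :=
  if h : p ∈ Gm.team then a ⟨p, h⟩ else b ⟨p, h⟩

/-- A joint opponent action is available at `s`. -/
def OppAvailable (s : Gm.State) (b : Gm.OppAct) : Prop := ∀ p, b p ∈ Gm.Av p.1 s

/-- One-step transition probability, under a full strategy profile, from state `s`
with history `h`, to state `t` (players randomise independently). -/
def stepProb (π : (p : Gm.Player) → Strategy Gm.toGameStructure p)
    (h : List Gm.State) (s t : Gm.State) : ℝ :=
  ∑ a : (p : Gm.Player) → Gm.Act p, (∏ p, (π p).toFun h s (a p)) * Gm.trans s a t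

/-- Probability of visiting the target within `n` steps, starting at state `s`
with history `h`. -/
def reachWithin (π : (p : Gm.Player) → Strategy Gm.toGameStructure p) :
    ℕ → List Gm.State → Gm.State → ℝ
  | 0, _, s => if s ∈ Gm.target then 1 else 0
  | n + 1, h, s =>
      if s ∈ Gm.target then 1
      else ∑ t, Gm.stepProb π h s t * reachWithin π n (h ++ [s]) t

/-- Probability of eventually reaching the target set, starting from state `s`. -/
def reachProbFrom (π : (p : Gm.Player) → Strategy Gm.toGameStructure p) (s : Gm.State) : ℝ :=
  ⨆ n : ℕ, Gm.reachWithin π n [] s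

/-- Probability of eventually reaching the target set from the initial state. -/
def reachProb (π : (p : Gm.Player) → Strategy Gm.toGameStructure p) : ℝ :=
  Gm.reachProbFrom π Gm.init

/-- Probability of visiting the target set for the first time exactly at step `k`. -/
def firstHit (π : (p : Gm.Player) → Strategy Gm.toGameStructure p) :
    ℕ → List Gm.State → Gm.State → ℝ
  | 0, _, s => if s ∈ Gm.target then 1 else 0
  | k + 1, h, s =>
      if s ∈ Gm.target then 0
      else ∑ t, Gm.stepProb π h s t * firstHit π k (h ++ [s]) t

/-- Expected `lam`-discounted payoff from the initial state: the play pays `lam ^ k`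
if it first visits the target at step `k`, and `0` if it never visits the target. -/
def discounted (π : (p : Gm.Player) → Strategy Gm.toGameStructure p) (lam : ℝ) : ℝ :=
  ∑' k : ℕ, lam ^ k * Gm.firstHit π k [] Gm.init

/-- A play (an infinite sequence of states from the initial state) is compatible with
a strategy profile if each of its transitions occurs with positive probability. -/
def CompatiblePlay (π : (p : Gm.Player) → Strategy Gm.toGameStructure p)
    (play : ℕ → Gm.State) : Prop :=
  play 0 = Gm.init ∧
  ∀ n, 0 < Gm.stepProb π (List.ofFn fun i : Fin n => play i.1) (play n) (play (n + 1))

/-- Expected value of the valuation `v` at the successor of `s`, when the team plays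
according to the collective selector `ξ` and the opponent plays the joint action `b`. -/
def preTeamAct (v : Gm.State → ℝ) (s : Gm.State) (ξ : Gm.TeamSelector s) (b : Gm.OppAct) : ℝ :=
  ∑ a : Gm.TeamAct, (∏ p, (ξ p).toFun (a p)) * ∑ t, Gm.trans s (Gm.combineAct a b) t * v t

/-- An opponent selector at state `s`: a distribution over available joint opponent actions. -/
structure OppSelector (s : Gm.State) where
  toFun : Gm.OppAct → ℝ
  nonneg : ∀ b, 0 ≤ toFun b
  support_av : ∀ b, ¬ Gm.OppAvailable s b → toFun b = 0
  sum_one : ∑ b, toFun b = 1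

/-- Expected value of `v` at the successor of `s` under a collective selector `ξ`
and an opponent selector `ζ`. -/
def preSel (v : Gm.State → ℝ) (s : Gm.State) (ξ : Gm.TeamSelector s) (ζ : Gm.OppSelector s) : ℝ :=
  ∑ b, ζ.toFun b * Gm.preTeamAct v s ξ b

/-- The predecessor operator: best one-step value the team can guarantee. -/
def pre (v : Gm.State → ℝ) (s : Gm.State) : ℝ :=
  ⨆ ξ : Gm.TeamSelector s, ⨅ ζ : Gm.OppSelector s, Gm.preSel v s ξ ζ

/-- The value iteration sequence: `vIter 0` is the indicator of the target set
and `vIter (n+1) = pre (vIter n)`. -/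
def vIter : ℕ → Gm.State → ℝ
  | 0 => fun s => if s ∈ Gm.target then 1 else 0
  | n + 1 => Gm.pre (vIter n)

/-- The max-min value of the game started at `s`. -/
def maxminFrom (s : Gm.State) : ℝ :=
  ⨆ σ : Gm.TeamStrategy, ⨅ τ : Gm.OppStrategy, Gm.reachProbFrom (Gm.combine σ τ) s

/-- The set of states from which the team can win almost surely. -/
def winSet : Set Gm.State :=
  {s | ∃ σ : Gm.TeamStrategy, ∀ τ : Gm.OppStrategy, Gm.reachProbFrom (Gm.combine σ τ) s = 1}

/-- Distribution of the successor of `s` when the team plays the collective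
selector `ξ` and the opponent plays the joint action `b`. -/
def succProbSel (s : Gm.State) (ξ : Gm.TeamSelector s) (b : Gm.OppAct) (t : Gm.State) : ℝ :=
  ∑ a : Gm.TeamAct, (∏ p, (ξ p).toFun (a p)) * Gm.trans s (Gm.combineAct a b) t

/-- Distribution of the successor of `s` (with history `h`) when the team plays the
collective strategy `σ` and the opponent plays the joint action `b`. -/
def succProbTeam (σ : Gm.TeamStrategy) (h : List Gm.State) (s : Gm.State)
    (b : Gm.OppAct) (t : Gm.State) : ℝ :=
  ∑ a : Gm.TeamAct, (∏ p, (σ p).toFun h s (a p)) * Gm.trans s (Gm.combineAct a b) t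

/-- The layered decomposition of the almost-sure winning set. -/
def wSeq : ℕ → Set Gm.State
  | 0 => ↑Gm.target
  | k + 1 =>
      wSeq k ∪
      {s ∈ Gm.winSet | ∃ ξ : Gm.TeamSelector s, ∀ b : Gm.OppAct, Gm.OppAvailable s b →
        (0 < ∑ t, (wSeq k).indicator (Gm.succProbSel s ξ b) t) ∧
        (∑ t, Gm.winSet.indicator (Gm.succProbSel s ξ b) t = 1)}

end Game

theorem exists_uniform_bound {ι : Type*} [Finite ι] (P : ι → ℕ → ℝ → Prop)
    (hP : ∀ i n m ε δ, n ≤ m → δ ≤ ε → P i n ε → P i m δ)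
    (h : ∀ i, ∃ n, ∃ ε, 0 < ε ∧ P i n ε) : ∃ n, ∃ ε, 0 < ε ∧ ∀ i, P i n ε := by
  choose n ε hε hn using h
  obtain ⟨N, hN⟩ := Finite.exists_le n
  have hev : ∀ᶠ δ in nhdsWithin (0 : ℝ) (Set.Ioi 0), ∀ i, δ ≤ ε i :=
    Filter.eventually_all.2 fun i =>
      Filter.Eventually.filter_mono nhdsWithin_le_nhds (eventually_le_nhds (hε i))
  obtain ⟨δ, hδ, hδ0⟩ := (hev.and self_mem_nhdsWithin).exists
  exact ⟨N, δ, hδ0, fun i => hP i _ _ _ _ (hN i) (hδ i) (hn i)⟩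

/-- The memoryless strategy that plays uniformly in a nonempty set of available actions. -/
def Strategy.uniform {G : GameStructure} {p : G.Player} (F : G.State → Finset (G.Act p))
    (hne : ∀ s, (F s).Nonempty) (hF : ∀ s, F s ⊆ G.Av p s) : Strategy G p where
  toFun _ s a := if a ∈ F s then ((F s).card : ℝ)⁻¹ else 0
  nonneg _ s _ := by split_ifs <;> positivity
  support_av _ s a ha := if_neg fun h => ha (hF s h)
  sum_one _ s := by
    have : ((F s).card : ℝ) ≠ 0 := by exact_mod_cast (hne s).card_pos.ne'
    simp [Finset.sum_ite_mem, this]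

theorem Strategy.uniform_pos_iff {G : GameStructure} {p : G.Player}
    {F : G.State → Finset (G.Act p)} {hne : ∀ s, (F s).Nonempty} {hF : ∀ s, F s ⊆ G.Av p s}
    {h : List G.State} {s : G.State} {a : G.Act p} :
    0 < (Strategy.uniform F hne hF).toFun h s a ↔ a ∈ F s := by
  have : (0 : ℝ) < (F s).card := by exact_mod_cast (hne s).card_pos
  by_cases ha : a ∈ F s <;> simp [Strategy.uniform, ha]
  exact hne s

namespace Game

variable {Gm : Game}

section Step

variable (π : (p : Gm.Player) → Strategy Gm.toGameStructure p)

theorem stepProb_nonneg (h : List Gm.State) (s t : Gm.State) : 0 ≤ Gm.stepProb π h s t :=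
  Finset.sum_nonneg fun _ _ =>
    mul_nonneg (Finset.prod_nonneg fun p _ => (π p).nonneg _ _ _) (Gm.trans_nonneg _ _ _)

theorem sum_stepProb (h : List Gm.State) (s : Gm.State) : ∑ t, Gm.stepProb π h s t = 1 := by
  unfold stepProb
  rw [Finset.sum_comm]
  simp_rw [← Finset.mul_sum, Gm.trans_sum, mul_one]
  rw [← Fintype.prod_sum]
  simp [Strategy.sum_one]

theorem reachWithin_of_mem_target {s : Gm.State} (hs : s ∈ Gm.target) (n : ℕ)
    (h : List Gm.State) : Gm.reachWithin π n h s = 1 := by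
  cases n <;> simp [reachWithin, hs]

theorem reachWithin_nonneg (n : ℕ) (h : List Gm.State) (s : Gm.State) :
    0 ≤ Gm.reachWithin π n h s := by
  induction n generalizing h s with
  | zero => unfold reachWithin; split_ifs <;> norm_num
  | succ n ih =>
    unfold reachWithin
    split_ifs
    · norm_num
    · exact Finset.sum_nonneg fun t _ => mul_nonneg (stepProb_nonneg π h s t) (ih _ _)

theorem reachWithin_le_one (n : ℕ) (h : List Gm.State) (s : Gm.State) :
    Gm.reachWithin π n h s ≤ 1 := by
  induction n generalizing h s with
  | zero => unfold reachWithin; split_ifs <;> norm_num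
  | succ n ih =>
    unfold reachWithin
    split_ifs
    · exact le_rfl
    · rw [← sum_stepProb π h s]
      exact Finset.sum_le_sum fun t _ =>
        mul_le_of_le_one_right (stepProb_nonneg π h s t) (ih _ _)

theorem reachWithin_mono (h : List Gm.State) (s : Gm.State) :
    Monotone fun n => Gm.reachWithin π n h s := by
  refine monotone_nat_of_le_succ fun n => ?_
  induction n generalizing h s with
  | zero =>
    by_cases hs : s ∈ Gm.target
    · simp [reachWithin_of_mem_target π hs]
    · simpa [reachWithin, hs] using reachWithin_nonneg π 1 h s
  | succ n ih =>
    by_cases hs : s ∈ Gm.target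
    · simp [reachWithin_of_mem_target π hs]
    · rw [reachWithin, reachWithin, if_neg hs, if_neg hs]
      exact Finset.sum_le_sum fun t _ =>
        mul_le_mul_of_nonneg_left (ih _ _) (stepProb_nonneg π h s t)

theorem reachWithin_succ_of_notMem {s : Gm.State} (hs : s ∉ Gm.target) (n : ℕ)
    (h : List Gm.State) : Gm.reachWithin π (n + 1) h s =
      ∑ t, Gm.stepProb π h s t * Gm.reachWithin π n (h ++ [s]) t := by
  rw [reachWithin, if_neg hs]

/-- If the target is reached within `m` steps with probability at least `c` from every state of a
set that cannot be left, then failing within `n + m` steps requires failing twice. -/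
theorem one_sub_reachWithin_add_le {R : Set Gm.State}
    (hR : ∀ h s t, s ∈ R → s ∉ Gm.target → 0 < Gm.stepProb π h s t → t ∈ R)
    {m : ℕ} {c : ℝ} (hc : ∀ h, ∀ s ∈ R, c ≤ Gm.reachWithin π m h s)
    (n : ℕ) (h : List Gm.State) {s : Gm.State} (hs : s ∈ R) :
    1 - Gm.reachWithin π (n + m) h s ≤ (1 - Gm.reachWithin π n h s) * (1 - c) := by
  induction n generalizing h s with
  | zero =>
    by_cases hst : s ∈ Gm.target
    · simp [reachWithin_of_mem_target π hst]
    · have := hc h s hs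
      simp only [zero_add, reachWithin, if_neg hst]
      linarith
  | succ n ih =>
    by_cases hst : s ∈ Gm.target
    · simp [reachWithin_of_mem_target π hst]
    · rw [Nat.add_right_comm, reachWithin_succ_of_notMem π hst, reachWithin_succ_of_notMem π hst,
        ← sum_stepProb π h s, ← Finset.sum_sub_distrib, ← Finset.sum_sub_distrib,
        Finset.sum_mul, sum_stepProb π h s]
      refine Finset.sum_le_sum fun t _ => ?_
      rcases (stepProb_nonneg π h s t).eq_or_lt with h0 | h0
      · simp [← h0]
      · have := mul_le_mul_of_nonneg_left (ih (h ++ [s]) (hR h s t hs hst h0)) h0.le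
        linarith

theorem reachProbFrom_eq_one_of_uniform {R : Set Gm.State}
    (hR : ∀ h s t, s ∈ R → s ∉ Gm.target → 0 < Gm.stepProb π h s t → t ∈ R)
    {n : ℕ} {ε : ℝ} (hε : 0 < ε) (hn : ∀ h, ∀ s ∈ R, ε ≤ Gm.reachWithin π n h s)
    {s : Gm.State} (hs : s ∈ R) : Gm.reachProbFrom π s = 1 := by
  have hε1 : ε ≤ 1 := (hn [] s hs).trans (reachWithin_le_one π n [] s)
  have hk : ∀ k : ℕ, ∀ h, ∀ s ∈ R, 1 - (1 - ε) ^ k ≤ Gm.reachWithin π (k * n) h s := by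
    intro k
    induction k with
    | zero => intro h s _; simpa using reachWithin_nonneg π 0 h s
    | succ k ih =>
      intro h s hs
      have h1 := one_sub_reachWithin_add_le π hR hn (k * n) h hs
      have h2 := mul_le_mul_of_nonneg_right
        (show 1 - Gm.reachWithin π (k * n) h s ≤ (1 - ε) ^ k by linarith [ih h s hs])
        (sub_nonneg.2 hε1)
      rw [Nat.succ_mul, pow_succ]
      linarith
  have hbdd : BddAbove (Set.range fun n => Gm.reachWithin π n [] s) :=
    ⟨1, by rintro _ ⟨n, rfl⟩; exact reachWithin_le_one π n [] s⟩
  refine le_antisymm (ciSup_le fun n => reachWithin_le_one π n [] s) ?_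
  have hlim : Filter.Tendsto (fun k : ℕ => 1 - (1 - ε) ^ k) Filter.atTop (nhds 1) := by
    simpa using (tendsto_pow_atTop_nhds_zero_of_lt_one (sub_nonneg.2 hε1)
      (by linarith : 1 - ε < 1)).const_sub 1
  exact le_of_tendsto' hlim fun k => (hk k [] s hs).trans (le_ciSup hbdd (k * n))

end Step

/-- Probability that the opponents play the joint action `b`. -/
def oppProb (τ : Gm.OppStrategy) (h : List Gm.State) (s : Gm.State) (b : Gm.OppAct) : ℝ :=
  ∏ p, (τ p).toFun h s (b p)

theorem oppProb_nonneg (τ : Gm.OppStrategy) (h : List Gm.State) (s : Gm.State)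
    (b : Gm.OppAct) : 0 ≤ oppProb τ h s b :=
  Finset.prod_nonneg fun p _ => (τ p).nonneg _ _ _

theorem sum_oppProb (τ : Gm.OppStrategy) (h : List Gm.State) (s : Gm.State) :
    ∑ b, oppProb τ h s b = 1 := by
  unfold oppProb
  rw [← Fintype.prod_sum]
  simp [Strategy.sum_one]

theorem oppProb_pos_iff {τ : Gm.OppStrategy} {h : List Gm.State} {s : Gm.State}
    {b : Gm.OppAct} : 0 < oppProb τ h s b ↔ ∀ p, 0 < (τ p).toFun h s (b p) := by
  refine ⟨fun hb p => ((τ p).nonneg _ _ _).lt_of_ne' fun h0 => hb.ne' ?_,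
    fun hb => Finset.prod_pos fun p _ => hb p⟩
  exact Finset.prod_eq_zero (Finset.mem_univ p) h0

theorem oppAvailable_of_oppProb_pos {τ : Gm.OppStrategy} {h : List Gm.State} {s : Gm.State}
    {b : Gm.OppAct} (hb : 0 < oppProb τ h s b) : Gm.OppAvailable s b := fun p => by
  by_contra hp
  exact (oppProb_pos_iff.1 hb p).ne' ((τ p).support_av h s _ hp)

theorem succProbTeam_nonneg (σ : Gm.TeamStrategy) (h : List Gm.State) (s : Gm.State)
    (b : Gm.OppAct) (t : Gm.State) : 0 ≤ Gm.succProbTeam σ h s b t :=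
  Finset.sum_nonneg fun _ _ =>
    mul_nonneg (Finset.prod_nonneg fun p _ => (σ p).nonneg _ _ _) (Gm.trans_nonneg _ _ _)

theorem succProbTeam_eq_nil {σ : Gm.TeamStrategy} (hσ : Gm.MemorylessTeam σ)
    (h : List Gm.State) (s : Gm.State) (b : Gm.OppAct) (t : Gm.State) :
    Gm.succProbTeam σ h s b t = Gm.succProbTeam σ [] s b t := by
  unfold succProbTeam
  simp_rw [fun p => hσ p h [] s]

theorem succProbTeam_pos_iff {σ : Gm.TeamStrategy} {h : List Gm.State} {s : Gm.State}
    {b : Gm.OppAct} {t : Gm.State} : 0 < Gm.succProbTeam σ h s b t ↔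
      ∃ a : Gm.TeamAct, (∀ p, 0 < (σ p).toFun h s (a p)) ∧
        0 < Gm.trans s (Gm.combineAct a b) t := by
  have hprod : ∀ a : Gm.TeamAct, 0 ≤ ∏ p, (σ p).toFun h s (a p) := fun a =>
    Finset.prod_nonneg fun p _ => (σ p).nonneg _ _ _
  unfold succProbTeam
  rw [Finset.sum_pos_iff_of_nonneg fun a _ => mul_nonneg (hprod a) (Gm.trans_nonneg _ _ _)]
  refine ⟨?_, ?_⟩
  · rintro ⟨a, -, ha⟩
    refine ⟨a, fun p => ((σ p).nonneg _ _ _).lt_of_ne' fun h0 => ?_,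
      pos_of_mul_pos_right ha (hprod a)⟩
    rw [Finset.prod_eq_zero (Finset.mem_univ p) h0, zero_mul] at ha
    exact ha.false
  · rintro ⟨a, ha, ht⟩
    exact ⟨a, Finset.mem_univ a, mul_pos (Finset.prod_pos fun p _ => ha p) ht⟩

theorem stepProb_combine (σ : Gm.TeamStrategy) (τ : Gm.OppStrategy) (h : List Gm.State)
    (s t : Gm.State) : Gm.stepProb (Gm.combine σ τ) h s t =
      ∑ b, oppProb τ h s b * Gm.succProbTeam σ h s b t := by
  unfold stepProb succProbTeam oppProb
  simp_rw [Finset.mul_sum]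
  rw [Finset.sum_comm, ← Fintype.sum_prod_type',
    ← (Equiv.piEquivPiSubtypeProd (· ∈ Gm.team) Gm.Act).symm.sum_comp]
  refine Finset.sum_congr rfl fun x _ => ?_
  have hx : (Equiv.piEquivPiSubtypeProd (· ∈ Gm.team) Gm.Act).symm x
      = Gm.combineAct x.1 x.2 := rfl
  rw [hx]
  have h1 : ∏ p : Gm.TeamPlayer,
      (Gm.combine σ τ p).toFun h s (Gm.combineAct x.1 x.2 p)
        = ∏ p, (σ p).toFun h s (x.1 p) :=
    Finset.prod_congr rfl fun p _ => by simp [combine, combineAct, p.2]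
  have h2 : ∏ p : Gm.OppPlayer,
      (Gm.combine σ τ p).toFun h s (Gm.combineAct x.1 x.2 p)
        = ∏ p, (τ p).toFun h s (x.2 p) :=
    Finset.prod_congr rfl fun p _ => by simp [combine, combineAct, p.2]
  have h3 : ∏ p, (Gm.combine σ τ p).toFun h s (Gm.combineAct x.1 x.2 p)
      = (∏ p, (σ p).toFun h s (x.1 p)) * ∏ p, (τ p).toFun h s (x.2 p) := by
    rw [← Fintype.prod_subtype_mul_prod_subtype (· ∈ Gm.team), ← h1, ← h2]
    congr!
  rw [h3]
  ring

theorem stepProb_combine_pos_iff {σ : Gm.TeamStrategy} (hσ : Gm.MemorylessTeam σ)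
    {τ : Gm.OppStrategy} {h : List Gm.State} {s t : Gm.State} :
    0 < Gm.stepProb (Gm.combine σ τ) h s t ↔
      ∃ b, 0 < oppProb τ h s b ∧ 0 < Gm.succProbTeam σ [] s b t := by
  rw [stepProb_combine, Finset.sum_pos_iff_of_nonneg fun b _ =>
    mul_nonneg (oppProb_nonneg τ h s b) (succProbTeam_nonneg σ h s b t)]
  simp_rw [succProbTeam_eq_nil hσ h]
  refine ⟨?_, fun ⟨b, h1, h2⟩ => ⟨b, Finset.mem_univ b, mul_pos h1 h2⟩⟩
  rintro ⟨b, -, hb⟩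
  exact ⟨b, pos_of_mul_pos_left hb (succProbTeam_nonneg σ [] s b t),
    pos_of_mul_pos_right hb (oppProb_nonneg τ h s b)⟩

/-- The states from which, whatever the opponents do, the target is reached with positive
probability, when `E s b t` says that `t` is a possible successor of `s` under the joint
opponent action `b`. -/
inductive Attracted (E : Gm.State → Gm.OppAct → Gm.State → Prop) : Gm.State → Prop
  | target {s : Gm.State} : s ∈ Gm.target → Attracted E s
  | step {s : Gm.State} (f : Gm.OppAct → Gm.State) :
      (∀ b, Gm.OppAvailable s b → E s b (f b)) →
      (∀ b, Gm.OppAvailable s b → Attracted E (f b)) → Attracted E s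

theorem exists_of_not_attracted {E : Gm.State → Gm.OppAct → Gm.State → Prop} {s : Gm.State}
    (hs : ¬ Attracted E s) :
    ∃ b, Gm.OppAvailable s b ∧ ∀ t, E s b t → ¬ Attracted E t := by
  by_contra! hcon
  have hf : ∀ b, ∃ t, Gm.OppAvailable s b → E s b t ∧ Attracted E t := fun b => by
    by_cases hb : Gm.OppAvailable s b
    · exact (hcon b hb).imp fun t ht _ => ht
    · exact ⟨s, fun h => absurd h hb⟩
  choose f hf using hf
  exact hs (.step f (fun b hb => (hf b hb).1) fun b hb => (hf b hb).2)

/-- One step of a play from a state outside the target. -/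
def PossibleStep (E : Gm.State → Gm.OppAct → Gm.State → Prop) (s t : Gm.State) : Prop :=
  s ∉ Gm.target ∧ ∃ b, Gm.OppAvailable s b ∧ E s b t

/-- `t` is a possible successor of `s` when the team plays `σ` and the opponents play `b`. -/
def PossibleSucc (σ : Gm.TeamStrategy) (s : Gm.State) (b : Gm.OppAct) (t : Gm.State) : Prop :=
  0 < Gm.succProbTeam σ [] s b t

theorem Attracted.exists_le_reachWithin {σ : Gm.TeamStrategy} (hσ : Gm.MemorylessTeam σ)
    {s : Gm.State} (hs : Attracted (PossibleSucc σ) s) :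
    ∃ n, ∃ ε, 0 < ε ∧ ∀ (τ : Gm.OppStrategy) (h : List Gm.State),
      ε ≤ Gm.reachWithin (Gm.combine σ τ) n h s := by
  induction hs with
  | target hs =>
    exact ⟨0, 1, one_pos, fun τ h => (reachWithin_of_mem_target _ hs 0 h).ge⟩
  | @step s f hf _ ih =>
    obtain ⟨n, ε, hε, hn⟩ := exists_uniform_bound
      (fun b n ε => Gm.OppAvailable s b → ∀ (τ : Gm.OppStrategy) (h : List Gm.State),
        ε ≤ Gm.succProbTeam σ [] s b (f b) ∧
          ε ≤ Gm.reachWithin (Gm.combine σ τ) n h (f b))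
      (fun b n m ε δ hnm hδ hP hb τ h => ⟨hδ.trans (hP hb τ h).1,
        (hδ.trans (hP hb τ h).2).trans (reachWithin_mono _ h (f b) hnm)⟩)
      (fun b => by
        by_cases hb : Gm.OppAvailable s b
        · obtain ⟨n, ε, hε, hn⟩ := ih b hb
          exact ⟨n, min (Gm.succProbTeam σ [] s b (f b)) ε, lt_min (hf b hb) hε,
            fun _ τ h => ⟨min_le_left _ _, (min_le_right _ _).trans (hn τ h)⟩⟩
        · exact ⟨0, 1, one_pos, fun h => absurd h hb⟩)
    by_cases hst : s ∈ Gm.target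
    · exact ⟨0, 1, one_pos, fun τ h => (reachWithin_of_mem_target _ hst 0 h).ge⟩
    refine ⟨n + 1, ε * ε, mul_pos hε hε, fun τ h => ?_⟩
    rw [reachWithin_succ_of_notMem _ hst]
    simp_rw [stepProb_combine, Finset.sum_mul]
    rw [Finset.sum_comm, ← one_mul (ε * ε), ← sum_oppProb τ h s, Finset.sum_mul]
    refine Finset.sum_le_sum fun b _ => ?_
    simp_rw [mul_assoc]
    rw [← Finset.mul_sum]
    rcases (oppProb_nonneg τ h s b).eq_or_lt with h0 | h0
    · simp [← h0]
    refine mul_le_mul_of_nonneg_left ?_ h0.le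
    obtain ⟨h1, h2⟩ := hn b (oppAvailable_of_oppProb_pos h0) τ (h ++ [s])
    rw [← succProbTeam_eq_nil hσ h] at h1
    refine (mul_le_mul h1 h2 hε.le (succProbTeam_nonneg _ _ _ _ _)).trans ?_
    exact Finset.single_le_sum
      (f := fun t => Gm.succProbTeam σ h s b t *
        Gm.reachWithin (Gm.combine σ τ) n (h ++ [s]) t)
      (fun t _ => mul_nonneg (succProbTeam_nonneg _ _ _ _ _) (reachWithin_nonneg _ _ _ _))
      (Finset.mem_univ (f b))

theorem reachProb_eq_one_of_attracted {σ : Gm.TeamStrategy} (hσ : Gm.MemorylessTeam σ)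
    (H : ∀ s, Relation.ReflTransGen (PossibleStep (PossibleSucc σ)) Gm.init s →
      Attracted (PossibleSucc σ) s) (τ : Gm.OppStrategy) :
    Gm.reachProb (Gm.combine σ τ) = 1 := by
  let R : Set Gm.State :=
    {s | Relation.ReflTransGen (PossibleStep (PossibleSucc σ)) Gm.init s}
  obtain ⟨n, ε, hε, hn⟩ := exists_uniform_bound
    (fun (s : R) n ε => ∀ h : List Gm.State, ε ≤ Gm.reachWithin (Gm.combine σ τ) n h s)
    (fun s n m ε δ hnm hδ hP h => (hδ.trans (hP h)).trans (reachWithin_mono _ h s hnm))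
    (fun s => by
      obtain ⟨n, ε, hε, hn⟩ := (H s s.2).exists_le_reachWithin hσ
      exact ⟨n, ε, hε, hn τ⟩)
  refine reachProbFrom_eq_one_of_uniform _ (R := R) ?_ hε (fun h s hs => hn ⟨s, hs⟩ h)
    Relation.ReflTransGen.refl
  intro h s t hs hst hpos
  obtain ⟨b, hb, ht⟩ := (stepProb_combine_pos_iff hσ).1 hpos
  exact Relation.ReflTransGen.tail hs ⟨hst, b, oppAvailable_of_oppProb_pos hb, ht⟩

/-- Opponents that randomise over all available actions while the state is attracted, and then
keep the play away from the attracted states, defeat the team with positive probability. -/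
theorem exists_reachProb_ne_one {σ : Gm.TeamStrategy} (hσ : Gm.MemorylessTeam σ)
    {r : Gm.State} (hr : Relation.ReflTransGen (PossibleStep (PossibleSucc σ)) Gm.init r)
    (hrA : ¬ Attracted (PossibleSucc σ) r) :
    ∃ τ : Gm.OppStrategy, Gm.reachProb (Gm.combine σ τ) ≠ 1 := by
  classical
  have hg : ∀ s, ∃ b, ¬ Attracted (PossibleSucc σ) s →
      Gm.OppAvailable s b ∧ ∀ t, PossibleSucc σ s b t → ¬ Attracted (PossibleSucc σ) t :=
    fun s => by
      by_cases hs : Attracted (PossibleSucc σ) s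
      · exact ⟨fun p => (Gm.av_nonempty p.1 s).choose, fun h => absurd hs h⟩
      · exact (exists_of_not_attracted hs).imp fun b hb _ => hb
  choose g hg using hg
  let F : (p : Gm.OppPlayer) → Gm.State → Finset (Gm.Act p.1) := fun p s =>
    if Attracted (PossibleSucc σ) s then Gm.Av p.1 s else {g s p}
  have hne : ∀ p s, (F p s).Nonempty := fun p s => by
    by_cases hs : Attracted (PossibleSucc σ) s
    · simpa only [F, if_pos hs] using Gm.av_nonempty p.1 s
    · simp [F, hs]
  have hF : ∀ p s, F p s ⊆ Gm.Av p.1 s := fun p s => by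
    by_cases hs : Attracted (PossibleSucc σ) s
    · simp [F, hs]
    · simpa [F, hs] using (hg s hs).1 p
  let τ : Gm.OppStrategy := fun p => Strategy.uniform (F p) (hne p) (hF p)
  have hτ : ∀ h s b, 0 < oppProb τ h s b ↔ ∀ p, b p ∈ F p s := fun h s b =>
    oppProb_pos_iff.trans (forall_congr' fun p => Strategy.uniform_pos_iff)
  have hzero : ∀ n h s, ¬ Attracted (PossibleSucc σ) s →
      Gm.reachWithin (Gm.combine σ τ) n h s = 0 := by
    intro n
    induction n with
    | zero => exact fun h s hs => if_neg fun hst => hs (.target hst)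
    | succ n ih =>
      intro h s hs
      rw [reachWithin_succ_of_notMem _ fun hst => hs (.target hst)]
      refine Finset.sum_eq_zero fun t _ => ?_
      rcases (stepProb_nonneg (Gm.combine σ τ) h s t).eq_or_lt with h0 | h0
      · rw [← h0, zero_mul]
      obtain ⟨b, hb, ht⟩ := (stepProb_combine_pos_iff hσ).1 h0
      have hbg : b = g s := funext fun p => by simpa [F, hs] using (hτ h s b).1 hb p
      rw [ih _ t ((hg s hs).2 t (hbg ▸ ht)), mul_zero]
  have hlt : ∃ δ < (1 : ℝ), ∀ n h, Gm.reachWithin (Gm.combine σ τ) n h Gm.init ≤ δ := by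
    generalize Gm.init = s₀ at hr
    induction hr using Relation.ReflTransGen.head_induction_on with
    | refl => exact ⟨0, one_pos, fun n h => (hzero n h r hrA).le⟩
    | @head s t hst _ ih =>
      obtain ⟨δ, hδ, hδn⟩ := ih
      obtain ⟨hsT, b, hb, ht⟩ := hst
      by_cases hs : Attracted (PossibleSucc σ) s
      swap
      · exact ⟨0, one_pos, fun n h => (hzero n h s hs).le⟩
      have hq : 0 < Gm.stepProb (Gm.combine σ τ) [] s t :=
        (stepProb_combine_pos_iff hσ).2
          ⟨b, (hτ [] s b).2 fun p => by simpa only [F, if_pos hs] using hb p, ht⟩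
      have hmem : ∀ h, Gm.stepProb (Gm.combine σ τ) h s t
          = Gm.stepProb (Gm.combine σ τ) [] s t := fun h => by
        simp_rw [stepProb_combine, succProbTeam_eq_nil hσ h]
        rfl
      refine ⟨1 - Gm.stepProb (Gm.combine σ τ) [] s t * (1 - δ),
        sub_lt_self _ (mul_pos hq (sub_pos.2 hδ)), fun n h => ?_⟩
      refine (reachWithin_mono _ h s (Nat.le_succ n)).trans ?_
      change Gm.reachWithin (Gm.combine σ τ) (n + 1) h s ≤ _
      rw [reachWithin_succ_of_notMem _ hsT, ← hmem h, le_sub_comm]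
      nth_rewrite 2 [← sum_stepProb (Gm.combine σ τ) h s]
      rw [← Finset.sum_sub_distrib]
      refine (mul_le_mul_of_nonneg_left (sub_le_sub_left (hδn n (h ++ [s])) 1)
        (stepProb_nonneg _ h s t)).trans ?_
      rw [mul_one_sub]
      exact Finset.single_le_sum
        (f := fun t => Gm.stepProb (Gm.combine σ τ) h s t -
          Gm.stepProb (Gm.combine σ τ) h s t *
            Gm.reachWithin (Gm.combine σ τ) n (h ++ [s]) t)
        (fun u _ => sub_nonneg.2 (mul_le_of_le_one_right (stepProb_nonneg _ _ _ _)
          (reachWithin_le_one _ _ _ _)))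
        (Finset.mem_univ t)
  obtain ⟨δ, hδ, hn⟩ := hlt
  exact ⟨τ, ((ciSup_le fun n => hn n []).trans_lt hδ).ne⟩

theorem forall_reachProb_eq_one_iff {σ : Gm.TeamStrategy} (hσ : Gm.MemorylessTeam σ) :
    (∀ τ : Gm.OppStrategy, Gm.reachProb (Gm.combine σ τ) = 1) ↔
      ∀ s, Relation.ReflTransGen (PossibleStep (PossibleSucc σ)) Gm.init s →
        Attracted (PossibleSucc σ) s := by
  refine ⟨fun H s hs => ?_, reachProb_eq_one_of_attracted hσ⟩
  by_contra hsA
  obtain ⟨τ, hτ⟩ := exists_reachProb_ne_one hσ hs hsA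
  exact hτ (H τ)

end Game

/-- Two memoryless collective strategies with the same support
(at every state, every team player plays the same set of actions with positive
probability) are equivalent for almost-sure reachability of the target. -/
theorem almost_sure_depends_only_on_support (Gm : Game) (σ σ' : Gm.TeamStrategy)
    (hσ : Gm.MemorylessTeam σ) (hσ' : Gm.MemorylessTeam σ')
    (hsupp : ∀ (p : Gm.TeamPlayer) (s : Gm.State) (a : Gm.Act p.1),
      0 < (σ p).toFun [] s a ↔ 0 < (σ' p).toFun [] s a) :
    (∀ τ : Gm.OppStrategy, Gm.reachProb (Gm.combine σ τ) = 1) ↔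
      (∀ τ : Gm.OppStrategy, Gm.reachProb (Gm.combine σ' τ) = 1) := by
  have hE : Game.PossibleSucc σ = Game.PossibleSucc σ' := by
    funext s b t
    simp only [Game.PossibleSucc, Game.succProbTeam_pos_iff, hsupp]
  rw [Game.forall_reachProb_eq_one_iff hσ, Game.forall_reachProb_eq_one_iff hσ', hE]
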